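/- arXiv:2601.12793 — 6 statements merged into one kernel-verified Lean document; each statement's English description precedes it below -/
import Mathlib

section
/- Fix Δt > 0 and an integer n ≥ 1, and set t^n := n·Δt, t^{n+1/2} := (n + 1/2)·Δt, t^{n−1/2} := (n − 1/2)·Δt. Let E be a real Banach space, let u : ℝ → E be five times continuously differentiable, and define R^n := (1/Δt)·[ ∫_{t^{n−1/2}}^{t^n} ((t^{n−1/2} − s)⁴/24)·u⁽⁵⁾(s) ds + ∫_{t^n}^{t^{n+1/2}} ((t^{n+1/2} − s)⁴/24)·u⁽⁵⁾(s) ds ]. Then ‖R^n‖² ≤ (Δt⁷/5184) · ∫_{t^{n−1/2}}^{t^{n+1/2}} ‖u⁽⁵⁾(s)‖² ds, where 5184 = 24²·9. -/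
open MeasureTheory intervalIntegral

/-- Cauchy-Schwarz inequality against the constant function on a bounded interval. -/
theorem sq_intervalIntegral_le_mul_intervalIntegral_sq {g : ℝ → ℝ} (hg : Continuous g)
    {a b : ℝ} (hab : a < b) :
    (∫ s in a..b, g s) ^ 2 ≤ (b - a) * ∫ s in a..b, g s ^ 2 := by
  set I := ∫ s in a..b, g s with hI
  have hL : 0 < b - a := sub_pos.2 hab
  have hnonneg : 0 ≤ ∫ s in a..b, ((b - a) * g s - I) ^ 2 :=
    intervalIntegral.integral_nonneg hab.le fun s _ => sq_nonneg _
  have hexpand : ∫ s in a..b, ((b - a) * g s - I) ^ 2 =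
      (b - a) * ((b - a) * (∫ s in a..b, g s ^ 2) - I ^ 2) := by
    have hfun : (fun s => ((b - a) * g s - I) ^ 2) =
        fun s => (b - a) ^ 2 * g s ^ 2 - 2 * (b - a) * I * g s + I ^ 2 := by
      funext s
      ring
    rw [hfun, intervalIntegral.integral_add, intervalIntegral.integral_sub,
      intervalIntegral.integral_const_mul, intervalIntegral.integral_const_mul,
      intervalIntegral.integral_const, smul_eq_mul, ← hI]
    · ring
    all_goals exact Continuous.intervalIntegrable (by fun_prop) _ _
  rw [hexpand] at hnonneg
  linarith [nonneg_of_mul_nonneg_right hnonneg hL]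

/-- A scalar kernel `(c - s) ^ 4 / 24` with `|c - s| ≤ h` on the interval of integration
contributes at most a factor `h ^ 4 / 24`. -/
theorem norm_intervalIntegral_quartic_smul_le
    {E : Type*} [NormedAddCommGroup E] [NormedSpace ℝ E]
    {f : ℝ → E} (hf : Continuous f) {a b c h : ℝ} (hab : a ≤ b)
    (hc : ∀ s ∈ Set.Icc a b, |c - s| ≤ h) :
    ‖∫ s in a..b, ((c - s) ^ 4 / 24) • f s‖ ≤ h ^ 4 / 24 * ∫ s in a..b, ‖f s‖ := by
  rw [← intervalIntegral.integral_const_mul]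
  refine norm_integral_le_of_norm_le hab (ae_of_all _ fun s hs => ?_)
    (Continuous.intervalIntegrable (by fun_prop) _ _)
  rw [norm_smul, norm_div, norm_pow, Real.norm_eq_abs, Real.norm_ofNat]
  gcongr
  exact hc s (Set.Ioc_subset_Icc_self hs)

/-- Bound on the squared norm of the fifth-order Taylor remainder of the centered
half-step difference quotient. -/
theorem half_step_remainder_sq_bound
    {E : Type*} [NormedAddCommGroup E] [NormedSpace ℝ E] [CompleteSpace E]
    (Δt : ℝ) (hΔt : 0 < Δt) (n : ℕ) (hn : 1 ≤ n)
    (u : ℝ → E) (hu : ContDiff ℝ 5 u) :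
    ‖Δt⁻¹ • ((∫ s in (((n : ℝ) - 1 / 2) * Δt)..((n : ℝ) * Δt),
          ((((n : ℝ) - 1 / 2) * Δt - s) ^ 4 / 24) • iteratedDeriv 5 u s) +
        ∫ s in ((n : ℝ) * Δt)..(((n : ℝ) + 1 / 2) * Δt),
          ((((n : ℝ) + 1 / 2) * Δt - s) ^ 4 / 24) • iteratedDeriv 5 u s)‖ ^ 2 ≤
      (Δt ^ 7 / 5184) *
        ∫ s in (((n : ℝ) - 1 / 2) * Δt)..(((n : ℝ) + 1 / 2) * Δt),
          ‖iteratedDeriv 5 u s‖ ^ 2 := by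
  have hf : Continuous (iteratedDeriv 5 u) := hu.continuous_iteratedDeriv 5 le_rfl
  generalize iteratedDeriv 5 u = f at hf ⊢
  set a := ((n : ℝ) - 1 / 2) * Δt with ha
  set m := (n : ℝ) * Δt with hm
  set b := ((n : ℝ) + 1 / 2) * Δt with hb
  have ham : m - a = Δt / 2 := by rw [ha, hm]; ring
  have hmb : b - m = Δt / 2 := by rw [hb, hm]; ring
  have hleft := norm_intervalIntegral_quartic_smul_le hf (a := a) (b := m) (c := a)
    (h := Δt / 2) (by linarith) fun s hs => abs_le.2 ⟨by linarith [hs.2], by linarith [hs.1]⟩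
  have hright := norm_intervalIntegral_quartic_smul_le hf (a := m) (b := b) (c := b)
    (h := Δt / 2) (by linarith) fun s hs => abs_le.2 ⟨by linarith [hs.2], by linarith [hs.1]⟩
  have hsplit : (∫ s in a..m, ‖f s‖) + ∫ s in m..b, ‖f s‖ = ∫ s in a..b, ‖f s‖ :=
    integral_add_adjacent_intervals (hf.norm.intervalIntegrable _ _)
      (hf.norm.intervalIntegrable _ _)
  have hcs := sq_intervalIntegral_le_mul_intervalIntegral_sq hf.norm
    (show a < b by linarith)
  rw [show b - a = Δt by linarith] at hcs
  have hJ : 0 ≤ ∫ s in a..b, ‖f s‖ ^ 2 :=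
    intervalIntegral.integral_nonneg (by linarith) fun s _ => sq_nonneg _
  have hnorm : ‖Δt⁻¹ • ((∫ s in a..m, ((a - s) ^ 4 / 24) • f s) +
      ∫ s in m..b, ((b - s) ^ 4 / 24) • f s)‖ ≤ Δt ^ 3 / 384 * ∫ s in a..b, ‖f s‖ := by
    rw [norm_smul, norm_inv, Real.norm_of_nonneg hΔt.le, inv_mul_le_iff₀ hΔt]
    calc _ ≤ _ := norm_add_le _ _
      _ ≤ _ := add_le_add hleft hright
      _ = _ := by rw [← hsplit]; ring
  calc _ ≤ (Δt ^ 3 / 384 * ∫ s in a..b, ‖f s‖) ^ 2 := by gcongr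
    _ = Δt ^ 6 / 147456 * (∫ s in a..b, ‖f s‖) ^ 2 := by ring
    _ ≤ Δt ^ 6 / 147456 * (Δt * ∫ s in a..b, ‖f s‖ ^ 2) := by gcongr
    _ = Δt ^ 7 / 147456 * ∫ s in a..b, ‖f s‖ ^ 2 := by ring
    _ ≤ Δt ^ 7 / 5184 * ∫ s in a..b, ‖f s‖ ^ 2 := by gcongr; norm_num
end

section
/- Fix Δt > 0, an integer N ≥ 2, and T > 0 with N·Δt ≤ T, and set t^k := k·Δt, t^{k±1/2} := (k ± 1/2)·Δt. Let E be a real Banach space, let u : ℝ → E be twice continuously differentiable, and for each n with 1 ≤ n ≤ N − 1 define r₁^n := (1/2)·[ ∫_{t^n}^{t^{n+1/2}} (t^{n+1/2} − s)·u″(s) ds − ∫_{t^{n−1/2}}^{t^n} (t^{n−1/2} − s)·u″(s) ds ]. Then ∑_{n=1}^{N−1} ‖r₁^n‖² ≤ (Δt³/48) · ∫_0^T ‖u″(s)‖² ds. -/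
open MeasureTheory intervalIntegral Finset

/-- The Cauchy–Schwarz inequality for interval integrals of continuous functions. -/
lemma sq_intervalIntegral_mul_le {w g : ℝ → ℝ} (hw : Continuous w) (hg : Continuous g)
    {a b : ℝ} (hab : a ≤ b) :
    (∫ s in a..b, w s * g s) ^ 2 ≤ (∫ s in a..b, w s ^ 2) * ∫ s in a..b, g s ^ 2 := by
  have key : ∀ x : ℝ, 0 ≤ (∫ s in a..b, w s ^ 2) * (x * x)
      + (2 * ∫ s in a..b, w s * g s) * x + ∫ s in a..b, g s ^ 2 := by
    intro x
    have hnonneg : 0 ≤ ∫ s in a..b, (x * w s + g s) ^ 2 :=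
      intervalIntegral.integral_nonneg hab fun s _ => sq_nonneg _
    have hexpand : ∫ s in a..b, (x * w s + g s) ^ 2 =
        ∫ s in a..b, ((x * x) * w s ^ 2 + (2 * x) * (w s * g s) + g s ^ 2) := by
      congr 1
      ext s
      ring
    rw [hexpand, intervalIntegral.integral_add, intervalIntegral.integral_add,
      intervalIntegral.integral_const_mul, intervalIntegral.integral_const_mul] at hnonneg
    · linarith
    all_goals exact Continuous.intervalIntegrable (by fun_prop) _ _
  have hdiscrim := discrim_le_zero key
  unfold discrim at hdiscrim
  nlinarith

/-- The Cauchy–Schwarz inequality for the interval integral of a vector-valued function against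
a scalar weight. -/
lemma sq_norm_intervalIntegral_smul_le {E : Type*} [NormedAddCommGroup E] [NormedSpace ℝ E]
    {w : ℝ → ℝ} {f : ℝ → E} (hw : Continuous w) (hf : Continuous f) {a b : ℝ} (hab : a ≤ b) :
    ‖∫ s in a..b, w s • f s‖ ^ 2 ≤ (∫ s in a..b, w s ^ 2) * ∫ s in a..b, ‖f s‖ ^ 2 := by
  have hnorm : ‖∫ s in a..b, w s • f s‖ ≤ ∫ s in a..b, |w s| * ‖f s‖ := by
    simpa only [norm_smul, Real.norm_eq_abs] using
      intervalIntegral.norm_integral_le_integral_norm (f := fun s => w s • f s) hab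
  calc ‖∫ s in a..b, w s • f s‖ ^ 2 ≤ (∫ s in a..b, |w s| * ‖f s‖) ^ 2 := by gcongr
    _ ≤ (∫ s in a..b, |w s| ^ 2) * ∫ s in a..b, ‖f s‖ ^ 2 :=
      sq_intervalIntegral_mul_le hw.abs hf.norm hab
    _ = _ := by simp only [sq_abs]

/-- Squared norm of a symmetric second-order Taylor remainder with midpoint `c` and
half-width `h`. -/
lemma sq_norm_symm_taylor_remainder_le {E : Type*} [NormedAddCommGroup E] [NormedSpace ℝ E]
    {f : ℝ → E} (hf : Continuous f) {a c b h : ℝ} (hh : 0 ≤ h) (ha : a = c - h)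
    (hb : b = c + h) :
    ‖(2 : ℝ)⁻¹ • ((∫ s in c..b, (b - s) • f s) - ∫ s in a..c, (a - s) • f s)‖ ^ 2 ≤
      h ^ 3 / 6 * ∫ s in a..b, ‖f s‖ ^ 2 := by
  have hright := sq_norm_intervalIntegral_smul_le (w := fun s => b - s) (by fun_prop) hf
    (show c ≤ b by linarith)
  have hleft := sq_norm_intervalIntegral_smul_le (w := fun s => a - s) (by fun_prop) hf
    (show a ≤ c by linarith)
  have hright_weight : ∫ s in c..b, (b - s) ^ 2 = h ^ 3 / 3 := by
    rw [intervalIntegral.integral_comp_sub_left (fun x => x ^ 2), integral_pow, hb]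
    norm_num
  have hleft_weight : ∫ s in a..c, (a - s) ^ 2 = h ^ 3 / 3 := by
    rw [intervalIntegral.integral_comp_sub_left (fun x => x ^ 2), integral_pow, ha]
    norm_num
    ring
  rw [hright_weight] at hright
  rw [hleft_weight] at hleft
  have hint (x y : ℝ) : IntervalIntegrable (fun s => ‖f s‖ ^ 2) volume x y :=
    Continuous.intervalIntegrable (by fun_prop) _ _
  rw [← intervalIntegral.integral_add_adjacent_intervals (hint a c) (hint c b), norm_smul,
    mul_pow]
  set X := ∫ s in c..b, (b - s) • f s
  set Y := ∫ s in a..c, (a - s) • f s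
  have hXY : ‖X - Y‖ ^ 2 ≤ (‖X‖ + ‖Y‖) ^ 2 := by
    gcongr
    exact norm_sub_le X Y
  norm_num
  nlinarith [sq_nonneg (‖X‖ - ‖Y‖)]

/-- Summed bound on the squared norms of the second-order Taylor remainders `r₁ⁿ`. -/
theorem r1_remainder_sq_sum_bound
    {E : Type*} [NormedAddCommGroup E] [NormedSpace ℝ E] [CompleteSpace E]
    (Δt T : ℝ) (hΔt : 0 < Δt) (hT : 0 < T) (N : ℕ) (hN : 2 ≤ N)
    (hNT : (N : ℝ) * Δt ≤ T)
    (u : ℝ → E) (hu : ContDiff ℝ 2 u) :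
    ∑ n ∈ Finset.Icc 1 (N - 1),
      ‖(2 : ℝ)⁻¹ • ((∫ s in ((n : ℝ) * Δt)..(((n : ℝ) + 1 / 2) * Δt),
            ((((n : ℝ) + 1 / 2) * Δt - s)) • iteratedDeriv 2 u s) -
          ∫ s in (((n : ℝ) - 1 / 2) * Δt)..((n : ℝ) * Δt),
            ((((n : ℝ) - 1 / 2) * Δt - s)) • iteratedDeriv 2 u s)‖ ^ 2 ≤
      (Δt ^ 3 / 48) * ∫ s in (0 : ℝ)..T, ‖iteratedDeriv 2 u s‖ ^ 2 := by
  have hf : Continuous (iteratedDeriv 2 u) := hu.continuous_iteratedDeriv 2 le_rfl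
  have hint (x y : ℝ) : IntervalIntegrable (fun s => ‖iteratedDeriv 2 u s‖ ^ 2) volume x y :=
    Continuous.intervalIntegrable (by fun_prop) _ _
  have hNcast : (2 : ℝ) ≤ N := by exact_mod_cast hN
  have hIcc : Finset.Icc 1 (N - 1) = Finset.Ico 1 N := by
    ext n
    simp only [Finset.mem_Icc, Finset.mem_Ico]
    omega
  have hsum := intervalIntegral.sum_integral_adjacent_intervals_Ico
    (a := fun k : ℕ => ((k : ℝ) - 1 / 2) * Δt) (μ := volume)
    (f := fun s => ‖iteratedDeriv 2 u s‖ ^ 2) (m := 1) (n := N) (by omega)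
    (fun k _ => hint _ _)
  calc _ ≤ ∑ n ∈ Finset.Icc 1 (N - 1), Δt ^ 3 / 48 *
        ∫ s in (((n : ℝ) - 1 / 2) * Δt)..((((n + 1 : ℕ) : ℝ) - 1 / 2) * Δt),
          ‖iteratedDeriv 2 u s‖ ^ 2 := by
        refine Finset.sum_le_sum fun n _ => ?_
        have hn := sq_norm_symm_taylor_remainder_le hf (a := ((n : ℝ) - 1 / 2) * Δt)
          (c := (n : ℝ) * Δt) (b := ((n : ℝ) + 1 / 2) * Δt) (h := Δt / 2) (by positivity)
          (by ring) (by ring)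
        have hend : (((n + 1 : ℕ) : ℝ) - 1 / 2) * Δt = ((n : ℝ) + 1 / 2) * Δt := by
          push_cast
          ring
        rw [hend]
        exact hn.trans_eq (by ring)
    _ = Δt ^ 3 / 48 * ∫ s in (((1 : ℕ) : ℝ) - 1 / 2) * Δt..((N : ℝ) - 1 / 2) * Δt,
          ‖iteratedDeriv 2 u s‖ ^ 2 := by
        rw [← Finset.mul_sum, hIcc, hsum]
    _ ≤ _ := by
        gcongr
        refine intervalIntegral.integral_mono_interval ?_ ?_ ?_
          (Filter.Eventually.of_forall fun s => sq_nonneg _) (hint _ _)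
        · norm_num
          positivity
        · gcongr
          linarith
        · nlinarith
end

section
/- Fix Δt > 0, an integer N ≥ 2, and T > 0 with N·Δt ≤ T, and set t^k := k·Δt, t^{k±1/2} := (k ± 1/2)·Δt. Let E be a real Banach space, let u : ℝ → E be four times continuously differentiable, and for each n with 1 ≤ n ≤ N − 1 define r₂^n := (1/2)·[ ∫_{t^n}^{t^{n+1/2}} ((t^{n+1/2} − s)³/6)·u⁽⁴⁾(s) ds − ∫_{t^{n−1/2}}^{t^n} ((t^{n−1/2} − s)³/6)·u⁽⁴⁾(s) ds ]. Then ∑_{n=1}^{N−1} ‖r₂^n‖² ≤ (Δt⁷/9216) · ∫_0^T ‖u⁽⁴⁾(s)‖² ds, where 9216 = 2⁷·72. -/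
open MeasureTheory intervalIntegral Finset

/-- The Cauchy–Schwarz inequality for interval integrals of continuous real functions. -/
theorem sq_integral_mul_le_of_continuous {a b : ℝ} (hab : a ≤ b) {k f : ℝ → ℝ}
    (hk : Continuous k) (hf : Continuous f) :
    (∫ s in a..b, k s * f s) ^ 2 ≤ (∫ s in a..b, k s ^ 2) * ∫ s in a..b, f s ^ 2 := by
  have hquad : ∀ x : ℝ, 0 ≤ (∫ s in a..b, f s ^ 2) * (x * x) +
      (2 * ∫ s in a..b, k s * f s) * x + ∫ s in a..b, k s ^ 2 := by
    intro x
    have hnonneg : 0 ≤ ∫ s in a..b, (x * f s + k s) ^ 2 :=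
      integral_nonneg hab fun s _ => sq_nonneg _
    have hexpand : ∫ s in a..b, (x * f s + k s) ^ 2 =
        ∫ s in a..b, ((x * x) * f s ^ 2 + (2 * x) * (k s * f s)) + k s ^ 2 := by
      congr 1
      ext s
      ring
    rw [hexpand, intervalIntegral.integral_add, intervalIntegral.integral_add,
      intervalIntegral.integral_const_mul, intervalIntegral.integral_const_mul] at hnonneg
    · linarith
    all_goals exact Continuous.intervalIntegrable (by fun_prop) _ _
  have hdiscrim := discrim_le_zero hquad
  unfold discrim at hdiscrim
  nlinarith

theorem integral_cubic_kernel_sq (a b c : ℝ) :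
    ∫ s in a..b, |(c - s) ^ 3 / 6| ^ 2 = ((c - a) ^ 7 - (c - b) ^ 7) / 252 := by
  have hpow : ∫ s in a..b, |(c - s) ^ 3 / 6| ^ 2 = ∫ s in a..b, (1 / 36) * (c - s) ^ 6 := by
    congr 1
    ext s
    rw [sq_abs]
    ring
  rw [hpow, intervalIntegral.integral_const_mul, integral_comp_sub_left (fun s => s ^ 6) c, integral_pow]
  norm_num
  ring

theorem norm_integral_cubic_kernel_smul_sq_le {E : Type*} [NormedAddCommGroup E]
    [NormedSpace ℝ E] {a b : ℝ} (hab : a ≤ b) (c : ℝ) {g : ℝ → E} (hg : Continuous g) :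
    ‖∫ s in a..b, ((c - s) ^ 3 / 6) • g s‖ ^ 2 ≤
      ((c - a) ^ 7 - (c - b) ^ 7) / 252 * ∫ s in a..b, ‖g s‖ ^ 2 := by
  have hnorm : ‖∫ s in a..b, ((c - s) ^ 3 / 6) • g s‖ ≤
      ∫ s in a..b, |(c - s) ^ 3 / 6| * ‖g s‖ := by
    refine (intervalIntegral.norm_integral_le_integral_norm hab).trans_eq ?_
    congr 1
    ext s
    rw [norm_smul, Real.norm_eq_abs]
  rw [← integral_cubic_kernel_sq]
  exact (pow_le_pow_left₀ (norm_nonneg _) hnorm 2).trans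
    (sq_integral_mul_le_of_continuous hab (by fun_prop) hg.norm)

theorem norm_half_smul_sub_sq_le {E : Type*} [NormedAddCommGroup E] [NormedSpace ℝ E]
    (x y : E) : ‖(2 : ℝ)⁻¹ • (x - y)‖ ^ 2 ≤ (‖x‖ ^ 2 + ‖y‖ ^ 2) / 2 := by
  have hsub : ‖x - y‖ ^ 2 ≤ (‖x‖ + ‖y‖) ^ 2 :=
    pow_le_pow_left₀ (norm_nonneg _) (norm_sub_le x y) 2
  rw [norm_smul, mul_pow]
  norm_num
  nlinarith [sq_nonneg (‖x‖ - ‖y‖)]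

theorem sum_Icc_integral_centered_intervals {f : ℝ → ℝ} (hf : Continuous f) (h : ℝ) (m : ℕ) :
    ∑ n ∈ Finset.Icc 1 m, ∫ s in (((n : ℝ) - 1 / 2) * h)..(((n : ℝ) + 1 / 2) * h), f s =
      ∫ s in (1 / 2 * h)..(((m : ℝ) + 1 / 2) * h), f s := by
  induction m with
  | zero => simp
  | succ m ih =>
    have hmid : ((m + 1 : ℕ) : ℝ) - 1 / 2 = m + 1 / 2 := by
      push_cast
      ring
    rw [Finset.sum_Icc_succ_top (by omega), ih, hmid]
    exact integral_add_adjacent_intervals (hf.intervalIntegrable _ _) (hf.intervalIntegrable _ _)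

/-- Summed bound on the squared norms of the fourth-order Taylor remainders `r₂ⁿ`. -/
theorem r2_remainder_sq_sum_bound
    {E : Type*} [NormedAddCommGroup E] [NormedSpace ℝ E] [CompleteSpace E]
    (Δt T : ℝ) (hΔt : 0 < Δt) (hT : 0 < T) (N : ℕ) (hN : 2 ≤ N)
    (hNT : (N : ℝ) * Δt ≤ T)
    (u : ℝ → E) (hu : ContDiff ℝ 4 u) :
    ∑ n ∈ Finset.Icc 1 (N - 1),
      ‖(2 : ℝ)⁻¹ • ((∫ s in ((n : ℝ) * Δt)..(((n : ℝ) + 1 / 2) * Δt),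
            ((((n : ℝ) + 1 / 2) * Δt - s) ^ 3 / 6) • iteratedDeriv 4 u s) -
          ∫ s in (((n : ℝ) - 1 / 2) * Δt)..((n : ℝ) * Δt),
            ((((n : ℝ) - 1 / 2) * Δt - s) ^ 3 / 6) • iteratedDeriv 4 u s)‖ ^ 2 ≤
      (Δt ^ 7 / 9216) * ∫ s in (0 : ℝ)..T, ‖iteratedDeriv 4 u s‖ ^ 2 := by
  have hg : Continuous (iteratedDeriv 4 u) := hu.continuous_iteratedDeriv 4 le_rfl
  have hg2 : Continuous fun s => ‖iteratedDeriv 4 u s‖ ^ 2 := by fun_prop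
  have hterm : ∀ n ∈ Finset.Icc 1 (N - 1),
      ‖(2 : ℝ)⁻¹ • ((∫ s in ((n : ℝ) * Δt)..(((n : ℝ) + 1 / 2) * Δt),
            ((((n : ℝ) + 1 / 2) * Δt - s) ^ 3 / 6) • iteratedDeriv 4 u s) -
          ∫ s in (((n : ℝ) - 1 / 2) * Δt)..((n : ℝ) * Δt),
            ((((n : ℝ) - 1 / 2) * Δt - s) ^ 3 / 6) • iteratedDeriv 4 u s)‖ ^ 2 ≤
      Δt ^ 7 / 9216 * ∫ s in (((n : ℝ) - 1 / 2) * Δt)..(((n : ℝ) + 1 / 2) * Δt),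
        ‖iteratedDeriv 4 u s‖ ^ 2 := by
    intro n _
    have hleft : ((n : ℝ) - 1 / 2) * Δt ≤ n * Δt := by nlinarith
    have hright : (n : ℝ) * Δt ≤ (n + 1 / 2) * Δt := by nlinarith
    have hx := norm_integral_cubic_kernel_smul_sq_le hright (((n : ℝ) + 1 / 2) * Δt) hg
    have hy := norm_integral_cubic_kernel_smul_sq_le hleft (((n : ℝ) - 1 / 2) * Δt) hg
    have hcx : ((((n : ℝ) + 1 / 2) * Δt - n * Δt) ^ 7 -
        (((n : ℝ) + 1 / 2) * Δt - (n + 1 / 2) * Δt) ^ 7) / 252 = Δt ^ 7 / 32256 := by ring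
    have hcy : ((((n : ℝ) - 1 / 2) * Δt - (n - 1 / 2) * Δt) ^ 7 -
        (((n : ℝ) - 1 / 2) * Δt - n * Δt) ^ 7) / 252 = Δt ^ 7 / 32256 := by ring
    rw [hcx] at hx
    rw [hcy] at hy
    have hnonneg : 0 ≤ Δt ^ 7 * ∫ s in (((n : ℝ) - 1 / 2) * Δt)..(((n : ℝ) + 1 / 2) * Δt),
        ‖iteratedDeriv 4 u s‖ ^ 2 :=
      mul_nonneg (by positivity)
        (integral_nonneg (hleft.trans hright) fun s _ => sq_nonneg _)
    refine (norm_half_smul_sub_sq_le _ _).trans ?_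
    rw [← integral_add_adjacent_intervals (hg2.intervalIntegrable _ (n * Δt))
      (hg2.intervalIntegrable _ _)] at hnonneg ⊢
    linarith
  refine (Finset.sum_le_sum hterm).trans ?_
  rw [← Finset.mul_sum, sum_Icc_integral_centered_intervals hg2]
  have hcast : ((N - 1 : ℕ) : ℝ) = N - 1 := by
    rw [Nat.cast_sub (by omega), Nat.cast_one]
  have hN' : (2 : ℝ) ≤ N := by exact_mod_cast hN
  refine mul_le_mul_of_nonneg_left ?_ (by positivity)
  rw [hcast]
  exact integral_mono_interval (by positivity) (by nlinarith) (by nlinarith)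
    (Filter.Eventually.of_forall fun s => sq_nonneg _) (hg2.intervalIntegrable _ _)
end

section
/- Fix Δt > 0 and an integer n ≥ 1, and set t^k := k·Δt. Let E be a real Banach space, let u : ℝ → E be five times continuously differentiable, and define R^n := (1/(2Δt))·[ ∫_{t^{n−1}}^{t^n} ((t^{n−1} − s)⁴/24)·u⁽⁵⁾(s) ds + ∫_{t^n}^{t^{n+1}} ((t^{n+1} − s)⁴/24)·u⁽⁵⁾(s) ds ]. Then ‖R^n‖² ≤ (2/81)·Δt⁷ · ∫_{t^{n−1}}^{t^{n+1}} ‖u⁽⁵⁾(s)‖² ds. -/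
open MeasureTheory intervalIntegral

/-- The Cauchy–Schwarz inequality against the constant function on an interval. -/
theorem sq_intervalIntegral_le_mul_integral_sq {f : ℝ → ℝ} (hf : Continuous f) {a b : ℝ}
    (hab : a < b) : (∫ s in a..b, f s) ^ 2 ≤ (b - a) * ∫ s in a..b, f s ^ 2 := by
  have hL : 0 < b - a := sub_pos.2 hab
  set M := ∫ s in a..b, f s with hM
  have h_nonneg : 0 ≤ ∫ s in a..b, ((b - a) * f s - M) ^ 2 :=
    integral_nonneg hab.le fun s _ => sq_nonneg _
  have h_expand : ∫ s in a..b, ((b - a) * f s - M) ^ 2 =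
      (b - a) ^ 2 * (∫ s in a..b, f s ^ 2) - 2 * (b - a) * M * M + (b - a) * M ^ 2 := by
    have h_eq : (fun s => ((b - a) * f s - M) ^ 2) =
        fun s => (b - a) ^ 2 * f s ^ 2 - 2 * (b - a) * M * f s + M ^ 2 := by
      funext s; ring
    rw [h_eq, integral_add (Continuous.intervalIntegrable (by fun_prop) _ _)
      (Continuous.intervalIntegrable (by fun_prop) _ _),
      integral_sub (Continuous.intervalIntegrable (by fun_prop) _ _)
      (Continuous.intervalIntegrable (by fun_prop) _ _), intervalIntegral.integral_const_mul,
      intervalIntegral.integral_const_mul, intervalIntegral.integral_const, smul_eq_mul, ← hM]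
  rw [h_expand] at h_nonneg
  refine le_of_mul_le_mul_left ?_ hL
  linarith

/-- An interval integral with a kernel bounded by `C` is at most `C` times the integral of the
norm. -/
theorem norm_intervalIntegral_smul_le {E : Type*} [NormedAddCommGroup E] [NormedSpace ℝ E]
    {k : ℝ → ℝ} {v : ℝ → E} (hv : Continuous v) {a b C : ℝ} (hab : a ≤ b)
    (hC : ∀ s ∈ Set.Icc a b, |k s| ≤ C) :
    ‖∫ s in a..b, k s • v s‖ ≤ C * ∫ s in a..b, ‖v s‖ := by
  rw [← intervalIntegral.integral_const_mul]
  refine norm_integral_le_of_norm_le hab (Filter.Eventually.of_forall fun s hs => ?_)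
    (Continuous.intervalIntegrable (by fun_prop) _ _)
  rw [norm_smul, Real.norm_eq_abs]
  exact mul_le_mul_of_nonneg_right (hC s (Set.Ioc_subset_Icc_self hs)) (norm_nonneg _)

/-- The quartic Taylor kernel is bounded by `d ^ 4 / 24` at distance at most `d`. -/
theorem abs_quartic_kernel_le {x d : ℝ} (h : |x| ≤ d) : |x ^ 4 / 24| ≤ d ^ 4 / 24 := by
  rw [abs_div, abs_pow, abs_of_pos (show (0 : ℝ) < 24 by norm_num)]
  gcongr

/-- Bound on the squared norm of the fifth-order Taylor remainder of the centered
full-step difference quotient. -/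
theorem full_step_remainder_sq_bound
    {E : Type*} [NormedAddCommGroup E] [NormedSpace ℝ E] [CompleteSpace E]
    (Δt : ℝ) (hΔt : 0 < Δt) (n : ℕ) (hn : 1 ≤ n)
    (u : ℝ → E) (hu : ContDiff ℝ 5 u) :
    ‖(2 * Δt)⁻¹ • ((∫ s in (((n : ℝ) - 1) * Δt)..((n : ℝ) * Δt),
          ((((n : ℝ) - 1) * Δt - s) ^ 4 / 24) • iteratedDeriv 5 u s) +
        ∫ s in ((n : ℝ) * Δt)..(((n : ℝ) + 1) * Δt),
          ((((n : ℝ) + 1) * Δt - s) ^ 4 / 24) • iteratedDeriv 5 u s)‖ ^ 2 ≤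
      (2 / 81) * Δt ^ 7 *
        ∫ s in (((n : ℝ) - 1) * Δt)..(((n : ℝ) + 1) * Δt),
          ‖iteratedDeriv 5 u s‖ ^ 2 := by
  have hv : Continuous (iteratedDeriv 5 u) := hu.continuous_iteratedDeriv 5 le_rfl
  generalize iteratedDeriv 5 u = v at hv ⊢
  have hab : ((n : ℝ) - 1) * Δt ≤ (n : ℝ) * Δt := by nlinarith
  have hbc : (n : ℝ) * Δt ≤ ((n : ℝ) + 1) * Δt := by nlinarith
  have h_left := norm_intervalIntegral_smul_le (k := fun s => (((n : ℝ) - 1) * Δt - s) ^ 4 / 24)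
    (C := Δt ^ 4 / 24) hv hab fun s hs => abs_quartic_kernel_le <| by
      rw [abs_le]; constructor <;> linarith [hs.1, hs.2]
  have h_right := norm_intervalIntegral_smul_le (k := fun s => (((n : ℝ) + 1) * Δt - s) ^ 4 / 24)
    (C := Δt ^ 4 / 24) hv hbc fun s hs => abs_quartic_kernel_le <| by
      rw [abs_le]; constructor <;> linarith [hs.1, hs.2]
  have h_adj := integral_add_adjacent_intervals (μ := volume)
    (hv.norm.intervalIntegrable (((n : ℝ) - 1) * Δt) ((n : ℝ) * Δt))
    (hv.norm.intervalIntegrable ((n : ℝ) * Δt) (((n : ℝ) + 1) * Δt))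
  have h_cs := sq_intervalIntegral_le_mul_integral_sq hv.norm
    (show ((n : ℝ) - 1) * Δt < ((n : ℝ) + 1) * Δt by nlinarith)
  have h_len : ((n : ℝ) + 1) * Δt - ((n : ℝ) - 1) * Δt = 2 * Δt := by ring
  rw [h_len] at h_cs
  have h_sq_nonneg : 0 ≤ ∫ s in (((n : ℝ) - 1) * Δt)..(((n : ℝ) + 1) * Δt), ‖v s‖ ^ 2 :=
    integral_nonneg (hab.trans hbc) fun s _ => sq_nonneg _
  have h_sum := (norm_add_le _ _).trans (add_le_add h_left h_right)
  rw [← mul_add, h_adj] at h_sum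
  rw [norm_smul, mul_pow, Real.norm_eq_abs, sq_abs]
  calc _ ≤ (2 * Δt)⁻¹ ^ 2 * (Δt ^ 4 / 24 *
        ∫ s in (((n : ℝ) - 1) * Δt)..(((n : ℝ) + 1) * Δt), ‖v s‖) ^ 2 := by gcongr
    _ ≤ (2 * Δt)⁻¹ ^ 2 * ((Δt ^ 4 / 24) ^ 2 * (2 * Δt *
        ∫ s in (((n : ℝ) - 1) * Δt)..(((n : ℝ) + 1) * Δt), ‖v s‖ ^ 2)) := by
      rw [mul_pow (Δt ^ 4 / 24)]; gcongr
    _ = 1 / 1152 * Δt ^ 7 *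
        ∫ s in (((n : ℝ) - 1) * Δt)..(((n : ℝ) + 1) * Δt), ‖v s‖ ^ 2 := by
      field_simp; ring
    _ ≤ _ := by gcongr <;> norm_num
end

section
/- Fix Δt > 0, an integer N ≥ 2, and T > 0 with N·Δt ≤ T, and set t^k := k·Δt. Let E be a real Banach space, let u : ℝ → E be five times continuously differentiable, and for each n with 1 ≤ n ≤ N − 1 define R^n := (1/(2Δt))·[ ∫_{t^{n−1}}^{t^n} ((t^{n−1} − s)⁴/24)·u⁽⁵⁾(s) ds + ∫_{t^n}^{t^{n+1}} ((t^{n+1} − s)⁴/24)·u⁽⁵⁾(s) ds ]. Then ∑_{n=1}^{N−1} ‖R^n‖² ≤ (4/81)·Δt⁷ · ∫_0^T ‖u⁽⁵⁾(s)‖² ds. -/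
open MeasureTheory intervalIntegral Finset

/-- Cauchy–Schwarz on an interval, against a bounded scalar kernel. -/
theorem sq_norm_integral_smul_le
    {E : Type*} [NormedAddCommGroup E] [NormedSpace ℝ E]
    {a b M : ℝ} (hab : a < b) {p : ℝ → ℝ} {v : ℝ → E} (hv : Continuous v)
    (hM : ∀ s ∈ Set.Icc a b, |p s| ≤ M) :
    ‖∫ s in a..b, p s • v s‖ ^ 2 ≤ M ^ 2 * (b - a) * ∫ s in a..b, ‖v s‖ ^ 2 := by
  have hM0 : 0 ≤ M := (abs_nonneg _).trans (hM a ⟨le_rfl, hab.le⟩)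
  have hnorm : ‖∫ s in a..b, p s • v s‖ ≤ M * ∫ s in a..b, ‖v s‖ := by
    rw [← intervalIntegral.integral_const_mul]
    refine intervalIntegral.norm_integral_le_of_norm_le hab.le (ae_of_all _ fun s hs => ?_)
      (Continuous.intervalIntegrable (by fun_prop) _ _)
    rw [norm_smul, Real.norm_eq_abs]
    exact mul_le_mul_of_nonneg_right (hM s ⟨hs.1.le, hs.2⟩) (norm_nonneg _)
  have hCS : (∫ s in a..b, ‖v s‖) ^ 2 ≤ (b - a) * ∫ s in a..b, ‖v s‖ ^ 2 := by
    set I := ∫ s in a..b, ‖v s‖ with hI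
    have hpos : 0 ≤ ∫ s in a..b, ((b - a) * ‖v s‖ - I) ^ 2 :=
      intervalIntegral.integral_nonneg hab.le fun s _ => sq_nonneg _
    have hexp : ∫ s in a..b, ((b - a) * ‖v s‖ - I) ^ 2 =
        (b - a) ^ 2 * (∫ s in a..b, ‖v s‖ ^ 2) - 2 * (b - a) * I * I + (b - a) * I ^ 2 := by
      have hfun : ∀ s, ((b - a) * ‖v s‖ - I) ^ 2 =
          (b - a) ^ 2 * ‖v s‖ ^ 2 - 2 * (b - a) * I * ‖v s‖ + I ^ 2 := fun s => by ring
      simp_rw [hfun]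
      rw [intervalIntegral.integral_add (Continuous.intervalIntegrable (by fun_prop) _ _)
          (Continuous.intervalIntegrable (by fun_prop) _ _),
        intervalIntegral.integral_sub (Continuous.intervalIntegrable (by fun_prop) _ _)
          (Continuous.intervalIntegrable (by fun_prop) _ _),
        intervalIntegral.integral_const_mul, intervalIntegral.integral_const_mul,
        intervalIntegral.integral_const, ← hI, smul_eq_mul]
    rw [hexp] at hpos
    have hba : 0 < b - a := sub_pos.2 hab
    refine le_of_mul_le_mul_left ?_ hba
    linarith
  calc ‖∫ s in a..b, p s • v s‖ ^ 2 ≤ (M * ∫ s in a..b, ‖v s‖) ^ 2 := by gcongr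
    _ = M ^ 2 * (∫ s in a..b, ‖v s‖) ^ 2 := by ring
    _ ≤ M ^ 2 * ((b - a) * ∫ s in a..b, ‖v s‖ ^ 2) := by gcongr
    _ = _ := by ring

/-- The remainder of the centered difference quotient at `x` with step `h` is controlled by the
squared norm of `v` over `[x - h, x + h]`. -/
theorem sq_norm_full_step_remainder_le
    {E : Type*} [NormedAddCommGroup E] [NormedSpace ℝ E]
    {h x y z : ℝ} (hh : 0 < h) (hxy : y - x = h) (hyz : z - y = h) {v : ℝ → E}
    (hv : Continuous v) :
    ‖(2 * h)⁻¹ • ((∫ s in x..y, ((x - s) ^ 4 / 24) • v s) +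
        ∫ s in y..z, ((z - s) ^ 4 / 24) • v s)‖ ^ 2 ≤
      h ^ 7 / 1152 * ∫ s in x..z, ‖v s‖ ^ 2 := by
  have hkernel : ∀ r : ℝ, |r| ≤ h → |r ^ 4 / 24| ≤ h ^ 4 / 24 := fun r hr => by
    rw [abs_div, abs_pow, abs_of_pos (by norm_num : (0 : ℝ) < 24)]
    gcongr
  have h1 := sq_norm_integral_smul_le (by linarith : x < y) (p := fun s => (x - s) ^ 4 / 24) hv
    fun s hs => hkernel _ (abs_le.2 ⟨by linarith [hs.2], by linarith [hs.1]⟩)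
  have h2 := sq_norm_integral_smul_le (by linarith : y < z) (p := fun s => (z - s) ^ 4 / 24) hv
    fun s hs => hkernel _ (abs_le.2 ⟨by linarith [hs.2], by linarith [hs.1]⟩)
  rw [hxy] at h1
  rw [hyz] at h2
  rw [← intervalIntegral.integral_add_adjacent_intervals (a := x) (b := y) (c := z)
    (f := fun s => ‖v s‖ ^ 2) (Continuous.intervalIntegrable (by fun_prop) _ _)
    (Continuous.intervalIntegrable (by fun_prop) _ _)]
  set A := ∫ s in x..y, ((x - s) ^ 4 / 24) • v s
  set B := ∫ s in y..z, ((z - s) ^ 4 / 24) • v s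
  set α := ∫ s in x..y, ‖v s‖ ^ 2
  set β := ∫ s in y..z, ‖v s‖ ^ 2
  have hAB : ‖A + B‖ ^ 2 ≤ 2 * (‖A‖ ^ 2 + ‖B‖ ^ 2) :=
    (pow_le_pow_left₀ (norm_nonneg _) (norm_add_le A B) 2).trans add_sq_le
  calc ‖(2 * h)⁻¹ • (A + B)‖ ^ 2 = ((2 * h)⁻¹) ^ 2 * ‖A + B‖ ^ 2 := by
        rw [norm_smul, mul_pow, Real.norm_eq_abs, sq_abs]
    _ ≤ ((2 * h)⁻¹) ^ 2 * (2 * ((h ^ 4 / 24) ^ 2 * h * α + (h ^ 4 / 24) ^ 2 * h * β)) := by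
        gcongr
        linarith
    _ = h ^ 7 / 1152 * (α + β) := by
        field_simp
        ring

/-- Summed bound on the squared norms of the fifth-order Taylor remainders of the
centered full-step difference quotients. -/
theorem full_step_remainder_sq_sum_bound
    {E : Type*} [NormedAddCommGroup E] [NormedSpace ℝ E] [CompleteSpace E]
    (Δt T : ℝ) (hΔt : 0 < Δt) (hT : 0 < T) (N : ℕ) (hN : 2 ≤ N)
    (hNT : (N : ℝ) * Δt ≤ T)
    (u : ℝ → E) (hu : ContDiff ℝ 5 u) :
    ∑ n ∈ Finset.Icc 1 (N - 1),
      ‖(2 * Δt)⁻¹ • ((∫ s in (((n : ℝ) - 1) * Δt)..((n : ℝ) * Δt),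
            ((((n : ℝ) - 1) * Δt - s) ^ 4 / 24) • iteratedDeriv 5 u s) +
          ∫ s in ((n : ℝ) * Δt)..(((n : ℝ) + 1) * Δt),
            ((((n : ℝ) + 1) * Δt - s) ^ 4 / 24) • iteratedDeriv 5 u s)‖ ^ 2 ≤
      (4 / 81) * Δt ^ 7 * ∫ s in (0 : ℝ)..T, ‖iteratedDeriv 5 u s‖ ^ 2 := by
  have hv : Continuous (iteratedDeriv 5 u) := hu.continuous_iteratedDeriv 5 le_rfl
  have hint : ∀ a b : ℝ, IntervalIntegrable (fun s => ‖iteratedDeriv 5 u s‖ ^ 2) volume a b :=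
    fun a b => Continuous.intervalIntegrable (by fun_prop) _ _
  set G : ℝ → ℝ := fun x => ∫ s in (0 : ℝ)..x, ‖iteratedDeriv 5 u s‖ ^ 2
  have hG_mono : ∀ x y, 0 ≤ x → x ≤ y → G x ≤ G y := fun x y hx hxy =>
    intervalIntegral.integral_mono_interval le_rfl hx hxy
      (ae_of_all _ fun s => sq_nonneg _) (hint _ _)
  have hG_nonneg : 0 ≤ G T :=
    intervalIntegral.integral_nonneg hT.le fun s _ => sq_nonneg _
  have hsum : ∀ m : ℕ, ∑ n ∈ Finset.Icc 1 m,
      ‖(2 * Δt)⁻¹ • ((∫ s in (((n : ℝ) - 1) * Δt)..((n : ℝ) * Δt),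
            ((((n : ℝ) - 1) * Δt - s) ^ 4 / 24) • iteratedDeriv 5 u s) +
          ∫ s in ((n : ℝ) * Δt)..(((n : ℝ) + 1) * Δt),
            ((((n : ℝ) + 1) * Δt - s) ^ 4 / 24) • iteratedDeriv 5 u s)‖ ^ 2 ≤
      Δt ^ 7 / 1152 * (G (m * Δt) + G ((m + 1) * Δt)) := by
    intro m
    induction m with
    | zero =>
      have h1 := hG_mono 0 Δt le_rfl hΔt.le
      have h0 : G 0 = 0 := intervalIntegral.integral_same
      rw [h0] at h1
      simp only [zero_lt_one, Finset.Icc_eq_empty_of_lt, Finset.sum_empty, Nat.cast_zero,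
        zero_mul, zero_add, one_mul, h0]
      positivity
    | succ m ih =>
      rw [Finset.sum_Icc_succ_top (by omega)]
      have hstep := sq_norm_full_step_remainder_le hΔt
        (x := (((m + 1 : ℕ) : ℝ) - 1) * Δt) (y := ((m + 1 : ℕ) : ℝ) * Δt)
        (z := (((m + 1 : ℕ) : ℝ) + 1) * Δt) (by ring) (by ring) hv
      rw [← intervalIntegral.integral_interval_sub_left (hint 0 _) (hint 0 _)] at hstep
      refine (add_le_add ih hstep).trans (le_of_eq ?_)
      simp only [G, Nat.cast_add, Nat.cast_one, add_sub_cancel_right]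
      ring
  have hcast : ((N - 1 : ℕ) : ℝ) = N - 1 := by
    rw [Nat.cast_sub (by omega), Nat.cast_one]
  have hN' : (2 : ℝ) ≤ N := by exact_mod_cast hN
  have hfirst : G (((N - 1 : ℕ) : ℝ) * Δt) ≤ G T :=
    hG_mono _ _ (by positivity) (by rw [hcast]; linarith)
  have hsecond : G ((((N - 1 : ℕ) : ℝ) + 1) * Δt) ≤ G T :=
    hG_mono _ _ (by positivity) (by rw [hcast]; linarith)
  calc _ ≤ Δt ^ 7 / 1152 * (G T + G T) := (hsum (N - 1)).trans (by gcongr)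
    _ ≤ 4 / 81 * Δt ^ 7 * G T := by
        have : 0 ≤ Δt ^ 7 * G T := by positivity
        linarith
end

section
/- Let H₁, H₂, H₃ be real inner product spaces, let N ≥ 2 be an integer, and let (pⁿ), (Eⁿ), (Hⁿ) be sequences in H₁, H₂, H₃ respectively, indexed by n = 0, 1, …, N. Assume that for every n with 1 ≤ n ≤ N − 1: ⟨p^{n+1} − p^{n−1}, p^{n+1} + 4pⁿ + p^{n−1}⟩ + ⟨E^{n+1} − E^{n−1}, E^{n+1} + 4Eⁿ + E^{n−1}⟩ + ⟨H^{n+1} − H^{n−1}, H^{n+1} + 4Hⁿ + H^{n−1}⟩ = 0. Define the discrete energy 𝓔ⁿ := ‖p^{n+1} + pⁿ‖² + 2⟨p^{n+1}, pⁿ⟩ + ‖E^{n+1} + Eⁿ‖² + 2⟨E^{n+1}, Eⁿ⟩ + ‖H^{n+1} + Hⁿ‖² + 2⟨H^{n+1}, Hⁿ⟩ for 0 ≤ n ≤ N − 1. Then 𝓔ⁿ = 𝓔^{n−1} for every n with 1 ≤ n ≤ N − 1; in particular 𝓔^{N−1} = 𝓔⁰. -/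
open scoped RealInnerProductSpace

/-- Pairing the difference of the outer terms with the combination `a + 4b + c` telescopes into a
difference of two-step energies. -/
theorem inner_sub_add_four_smul_add {V : Type*} [NormedAddCommGroup V] [InnerProductSpace ℝ V]
    (a b c : V) :
    ⟪a - c, a + (4 : ℝ) • b + c⟫ =
      (‖a + b‖ ^ 2 + 2 * ⟪a, b⟫) - (‖b + c‖ ^ 2 + 2 * ⟪b, c⟫) := by
  simp only [norm_add_sq_real, inner_sub_left, inner_add_right, real_inner_smul_right,
    real_inner_self_eq_norm_sq, real_inner_comm c a, real_inner_comm c b]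
  ring

/-- Discrete energy conservation for the TS₄ scheme. -/
theorem ts4_discrete_energy_conservation
    {H₁ H₂ H₃ : Type*}
    [NormedAddCommGroup H₁] [InnerProductSpace ℝ H₁]
    [NormedAddCommGroup H₂] [InnerProductSpace ℝ H₂]
    [NormedAddCommGroup H₃] [InnerProductSpace ℝ H₃]
    (N : ℕ) (hN : 2 ≤ N)
    (p : ℕ → H₁) (E : ℕ → H₂) (H : ℕ → H₃)
    (hyp : ∀ n, 1 ≤ n → n ≤ N - 1 →
      ⟪p (n + 1) - p (n - 1), p (n + 1) + (4 : ℝ) • p n + p (n - 1)⟫ +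
      ⟪E (n + 1) - E (n - 1), E (n + 1) + (4 : ℝ) • E n + E (n - 1)⟫ +
      ⟪H (n + 1) - H (n - 1), H (n + 1) + (4 : ℝ) • H n + H (n - 1)⟫ = 0)
    (𝓔 : ℕ → ℝ)
    (h𝓔 : ∀ n, n ≤ N - 1 → 𝓔 n =
      ‖p (n + 1) + p n‖ ^ 2 + 2 * ⟪p (n + 1), p n⟫ +
      ‖E (n + 1) + E n‖ ^ 2 + 2 * ⟪E (n + 1), E n⟫ +
      ‖H (n + 1) + H n‖ ^ 2 + 2 * ⟪H (n + 1), H n⟫) :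
    (∀ n, 1 ≤ n → n ≤ N - 1 → 𝓔 n = 𝓔 (n - 1)) ∧ 𝓔 (N - 1) = 𝓔 0 := by
  have step : ∀ n, 1 ≤ n → n ≤ N - 1 → 𝓔 n = 𝓔 (n - 1) := by
    intro n hn hnN
    have h := hyp n hn hnN
    simp only [inner_sub_add_four_smul_add] at h
    rw [h𝓔 n hnN, h𝓔 (n - 1) (by omega), Nat.sub_add_cancel hn]
    linarith
  have const : ∀ n, n ≤ N - 1 → 𝓔 n = 𝓔 0 := by
    intro n
    induction n with
    | zero => exact fun _ => rfl
    | succ k ih => exact fun hk => (step (k + 1) (by omega) hk).trans (ih (by omega))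
  exact ⟨step, const (N - 1) le_rfl⟩
end
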